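/- Let G be a countably infinite discrete amenable group, let A be a finite set, and let X ⊆ A^G be a subshift. Fix a tempered Følner sequence {F_n} of G with F_1 ⊆ F_2 ⊆ ⋯ and ⋃_n F_n = G, and let d be the associated metric on A^G. Then the Hausdorff dimension of X with respect to d equals the Bowen dimensional entropy: dim(X) = h^B_top(X,{F_n}). -/

import Mathlib

open Filter Topology Pointwise Set
open scoped ENNReal NNReal

attribute [local instance] Classical.propDecidable

section Defs

variable {G : Type*} [Group G] [DecidableEq G]

/-- `F` is a (left) Følner sequence: each `F n` is nonempty and
`|F n ∆ gF n| / |F n| → 0` for every `g ∈ G`. -/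
def IsFolnerSeq (F : ℕ → Finset G) : Prop :=
  (∀ n, (F n).Nonempty) ∧
    ∀ g : G, Filter.Tendsto
      (fun n => ((symmDiff (F n) ((F n).image (fun h => g * h))).card : ℝ) / ((F n).card : ℝ))
      Filter.atTop (nhds 0)

/-- `F` is tempered: there is `C > 0` with `|⋃_{k<n} (F k)⁻¹ (F n)| ≤ C |F n|` for all `n`. -/
def IsTemperedSeq (F : ℕ → Finset G) : Prop :=
  ∃ C : ℝ, 0 < C ∧ ∀ n : ℕ,
    ((((Finset.range n).biUnion fun k => (F k)⁻¹ * F n)).card : ℝ) ≤ C * ((F n).card : ℝ)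

variable {A : Type*}

/-- The (left) shift action of `G` on `A^G`: `(g' • x) g = x (g g')`. -/
def shift (g' : G) (x : G → A) : G → A := fun g => x (g * g')

/-- A subshift: a closed shift-invariant subset of `A^G` (with the product topology). -/
def IsSubshift [TopologicalSpace A] (X : Set (G → A)) : Prop :=
  IsClosed X ∧ ∀ g : G, ∀ x ∈ X, shift g x ∈ X

/-- The metric on `A^G` associated to a nested Følner sequence exhausting `G`:
`d(x,x) = 0`; `d(x,y) = 1` if `x` and `y` are not equal on `F 0`; otherwise
`d(x,y) = e^{-|F n|}` where `n` is the maximal index such that `x` and `y` agree on `F n`. -/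
noncomputable def subshiftDist (Fseq : ℕ → Finset G) (x y : G → A) : ℝ :=
  if x = y then 0
  else if ∀ g ∈ Fseq 0, x g = y g then
    Real.exp (-((Fseq (sSup {n : ℕ | ∀ g ∈ Fseq n, x g = y g})).card : ℝ))
  else 1

/-- The diameter of a subset of `A^G` with respect to the metric `subshiftDist`. -/
noncomputable def sdiam (Fseq : ℕ → Finset G) (E : Set (G → A)) : ℝ≥0∞ :=
  ⨆ (x : E) (y : E), ENNReal.ofReal (subshiftDist Fseq (x : G → A) (y : G → A))

/-- The `s`-dimensional Hausdorff (outer) measure of `X ⊆ A^G` for the metric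
`subshiftDist`: `μ_s(X) = lim_{ε→0} inf_𝓔 ∑_{E∈𝓔} diam(E)^s`, the infimum over countable
covers `𝓔` of `X` by sets of diameter at most `ε` (the infimum is nondecreasing as `ε`
decreases, so the limit is the supremum over `ε > 0`). -/
noncomputable def hMeasure (Fseq : ℕ → Finset G) (s : ℝ) (X : Set (G → A)) : ℝ≥0∞ :=
  ⨆ (ε : ℝ) (_ : 0 < ε),
    ⨅ (𝓔 : Set (Set (G → A))) (_ : 𝓔.Countable) (_ : X ⊆ ⋃₀ 𝓔)
      (_ : ∀ E ∈ 𝓔, sdiam Fseq E ≤ ENNReal.ofReal ε),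
      ∑' E : 𝓔, sdiam Fseq (E : Set (G → A)) ^ s

/-- The Hausdorff dimension `dim(X) = inf {s ≥ 0 : μ_s(X) = 0}`. -/
noncomputable def hDim (Fseq : ℕ → Finset G) (X : Set (G → A)) : ℝ≥0∞ :=
  ⨅ (s : ℝ≥0) (_ : hMeasure Fseq (s : ℝ) X = 0), (s : ℝ≥0∞)

/-- The set `X(U) = ⋂_{g ∈ F} g⁻¹ U_g` associated to a `(𝒰,F)`-name `u`, for the shift
action. -/
def nameSet (F : Finset G) (u : G → Set (G → A)) : Set (G → A) :=
  {x : G → A | ∀ g ∈ F, shift g x ∈ u g}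

/-- `𝒰` is a finite open cover of the set `Z`. -/
def IsFiniteOpenCoverOn [TopologicalSpace A] (𝒰 : Finset (Set (G → A))) (Z : Set (G → A)) :
    Prop :=
  (∀ V ∈ 𝒰, IsOpen V) ∧ Z ⊆ ⋃₀ (𝒰 : Set (Set (G → A)))

/-- `N(⋁_{g ∈ F} g⁻¹ 𝒰)` relative to `Z`: the minimal cardinality of a family of
`(𝒰,F)`-names whose associated sets cover `Z`. -/
noncomputable def covNum (𝒰 : Finset (Set (G → A))) (F : Finset G) (Z : Set (G → A)) : ℕ :=
  sInf {k : ℕ | ∃ Λ : Finset (G → Set (G → A)), Λ.card = k ∧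
    (∀ u ∈ Λ, ∀ g ∈ F, u g ∈ 𝒰) ∧ Z ⊆ ⋃ u ∈ Λ, nameSet F u}

/-- The entropy of the cover `𝒰` along the Følner sequence `Fseq`,
`lim_n (1/|F n|) log N(⋁_{g ∈ F n} g⁻¹𝒰)` (the limit exists by the Ornstein–Weiss lemma,
so we may express it as a `limsup`). -/
noncomputable def coverEntropyOf (Fseq : ℕ → Finset G) (𝒰 : Finset (Set (G → A)))
    (Z : Set (G → A)) : ℝ≥0∞ :=
  Filter.limsup
    (fun n => ENNReal.ofReal (Real.log (covNum 𝒰 (Fseq n) Z) / ((Fseq n).card : ℝ)))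
    Filter.atTop

/-- The topological entropy of the subshift `X`:
`h_top(X,G) = sup_𝒰 lim_n (1/|F n|) log N(⋁_{g∈F n} g⁻¹𝒰)`,
the supremum over finite open covers `𝒰` of `X`. -/
noncomputable def topEntropy [TopologicalSpace A] (Fseq : ℕ → Finset G)
    (X : Set (G → A)) : ℝ≥0∞ :=
  ⨆ (𝒰 : Finset (Set (G → A))) (_ : IsFiniteOpenCoverOn 𝒰 X), coverEntropyOf Fseq 𝒰 X

/-- `ℳ(Z,𝒰,N,s,{F n})`: the infimum of `∑_{U ∈ Λ} exp(-s·m(U))` over all collections `Λ`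
of `(𝒰, F j)`-names with `j ≥ N` whose associated sets cover `Z`. -/
noncomputable def bowenM (Fseq : ℕ → Finset G) (𝒰 : Finset (Set (G → A)))
    (Z : Set (G → A)) (N : ℕ) (s : ℝ) : ℝ≥0∞ :=
  ⨅ (Λ : Set (ℕ × (G → Set (G → A))))
    (_ : ∀ p ∈ Λ, N ≤ p.1 ∧ ∀ g ∈ Fseq p.1, p.2 g ∈ 𝒰)
    (_ : Z ⊆ ⋃ p ∈ Λ, nameSet (Fseq p.1) p.2),
    ∑' p : Λ, ENNReal.ofReal (Real.exp (-s * ((Fseq p.1.1).card : ℝ)))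

/-- `ℳ(Z,𝒰,s,{F n}) = lim_{N→∞} ℳ(Z,𝒰,N,s,{F n})`; the quantity is nondecreasing in `N`,
so the limit is the supremum. -/
noncomputable def bowenMlim (Fseq : ℕ → Finset G) (𝒰 : Finset (Set (G → A)))
    (Z : Set (G → A)) (s : ℝ) : ℝ≥0∞ :=
  ⨆ N : ℕ, bowenM Fseq 𝒰 Z N s

/-- `h^B_top(𝒰,Z,{F n}) = inf {s ≥ 0 : ℳ(Z,𝒰,s,{F n}) = 0}`. -/
noncomputable def bowenEntropyCover (Fseq : ℕ → Finset G) (𝒰 : Finset (Set (G → A)))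
    (Z : Set (G → A)) : ℝ≥0∞ :=
  ⨅ (s : ℝ≥0) (_ : bowenMlim Fseq 𝒰 Z (s : ℝ) = 0), (s : ℝ≥0∞)

/-- The Bowen (dimensional) topological entropy of the subshift `X`:
`h^B_top(X,{F n}) = sup_𝒰 h^B_top(𝒰,X,{F n})` over finite open covers `𝒰` of `X`. -/
noncomputable def bowenEntropy [TopologicalSpace A] (Fseq : ℕ → Finset G)
    (X : Set (G → A)) : ℝ≥0∞ :=
  ⨆ (𝒰 : Finset (Set (G → A))) (_ : IsFiniteOpenCoverOn 𝒰 X), bowenEntropyCover Fseq 𝒰 X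

/-- The cylinder `[ω]_{F n} = {x ∈ A^G : x g = ω g for every g ∈ F n}`. -/
def cylinder (Fseq : ℕ → Finset G) (n : ℕ) (ω : G → A) : Set (G → A) :=
  {x : G → A | ∀ g ∈ Fseq n, x g = ω g}

end Defs

section Metric

variable {G A : Type*} {Fseq : ℕ → Finset G}

theorem bddAbove_agreement (hmono : Monotone Fseq) (hexh : ∀ g : G, ∃ n, g ∈ Fseq n)
    {x y : G → A} (hxy : x ≠ y) : BddAbove {n : ℕ | ∀ g ∈ Fseq n, x g = y g} := by
  obtain ⟨g, hg⟩ := Function.ne_iff.1 hxy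
  obtain ⟨m, hm⟩ := hexh g
  exact ⟨m, fun n hn => le_of_not_ge fun h => hg (hn g (hmono h hm))⟩

theorem subshiftDist_le_exp (hmono : Monotone Fseq) (hexh : ∀ g : G, ∃ n, g ∈ Fseq n)
    {x y : G → A} {n : ℕ} (h : ∀ g ∈ Fseq n, x g = y g) :
    subshiftDist Fseq x y ≤ Real.exp (-((Fseq n).card : ℝ)) := by
  unfold subshiftDist
  split_ifs with h1 h2
  · positivity
  · have hle : n ≤ sSup {n : ℕ | ∀ g ∈ Fseq n, x g = y g} :=
      le_csSup (bddAbove_agreement hmono hexh h1) h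
    have := Finset.card_le_card (hmono hle)
    gcongr
  · exact absurd (fun g hg => h g (hmono (Nat.zero_le n) hg)) h2

theorem exp_le_subshiftDist (hmono : Monotone Fseq) {x y : G → A} {n : ℕ}
    (h : ¬ ∀ g ∈ Fseq (n + 1), x g = y g) :
    Real.exp (-((Fseq n).card : ℝ)) ≤ subshiftDist Fseq x y := by
  unfold subshiftDist
  split_ifs with h1 h2
  · exact absurd (fun g _ => congrFun h1 g) h
  · have hle : sSup {n : ℕ | ∀ g ∈ Fseq n, x g = y g} ≤ n := by
      refine csSup_le ⟨0, h2⟩ fun m hm => ?_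
      by_contra! hlt
      exact h fun g hg => hm g (hmono hlt hg)
    have := Finset.card_le_card (hmono hle)
    gcongr
  · simp

theorem eq_on_of_subshiftDist_le (hne : ∀ n, (Fseq n).Nonempty) (hmono : Monotone Fseq)
    (hexh : ∀ g : G, ∃ n, g ∈ Fseq n) {x y : G → A} {n : ℕ}
    (h : subshiftDist Fseq x y ≤ Real.exp (-((Fseq n).card : ℝ))) :
    ∀ g ∈ Fseq n, x g = y g := by
  unfold subshiftDist at h
  split_ifs at h with h1 h2
  · exact fun g _ => congrFun h1 g
  · have hmem : sSup {n : ℕ | ∀ g ∈ Fseq n, x g = y g} ∈ {n : ℕ | ∀ g ∈ Fseq n, x g = y g} :=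
      Nat.sSup_mem ⟨0, h2⟩ (bddAbove_agreement hmono hexh h1)
    set m := sSup {n : ℕ | ∀ g ∈ Fseq n, x g = y g}
    have hcard : (Fseq n).card ≤ (Fseq m).card := by
      have := Real.exp_le_exp.1 h
      exact_mod_cast neg_le_neg_iff.1 this
    rcases le_total n m with hnm | hmn
    · exact fun g hg => hmem g (hmono hnm hg)
    · rw [← Finset.eq_of_subset_of_card_le (hmono hmn) hcard]
      exact hmem
  · have hpos : (0 : ℝ) < (Fseq n).card := by exact_mod_cast (hne n).card_pos
    have : Real.exp (-((Fseq n).card : ℝ)) < 1 := Real.exp_lt_one_iff.2 (by linarith)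
    linarith

theorem sdiam_le_exp (hmono : Monotone Fseq) (hexh : ∀ g : G, ∃ n, g ∈ Fseq n)
    {E : Set (G → A)} {n : ℕ} (h : ∀ x ∈ E, ∀ y ∈ E, ∀ g ∈ Fseq n, x g = y g) :
    sdiam Fseq E ≤ ENNReal.ofReal (Real.exp (-((Fseq n).card : ℝ))) :=
  iSup₂_le fun x y =>
    ENNReal.ofReal_le_ofReal (subshiftDist_le_exp hmono hexh (h x x.2 y y.2))

theorem subshiftDist_le_sdiam {E : Set (G → A)} {x y : G → A} (hx : x ∈ E) (hy : y ∈ E) :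
    ENNReal.ofReal (subshiftDist Fseq x y) ≤ sdiam Fseq E :=
  le_iSup₂ (f := fun x y : E => ENNReal.ofReal (subshiftDist Fseq (x : G → A) (y : G → A)))
    ⟨x, hx⟩ ⟨y, hy⟩

theorem eq_on_of_sdiam_le (hne : ∀ n, (Fseq n).Nonempty) (hmono : Monotone Fseq)
    (hexh : ∀ g : G, ∃ n, g ∈ Fseq n) {E : Set (G → A)} {n : ℕ}
    (h : sdiam Fseq E ≤ ENNReal.ofReal (Real.exp (-((Fseq n).card : ℝ)))) :
    ∀ x ∈ E, ∀ y ∈ E, ∀ g ∈ Fseq n, x g = y g := fun _ hx _ hy =>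
  eq_on_of_subshiftDist_le hne hmono hexh <|
    (ENNReal.ofReal_le_ofReal_iff (Real.exp_pos _).le).1 ((subshiftDist_le_sdiam hx hy).trans h)

theorem ofReal_exp_neg_rpow {s : ℝ} (c : ℝ) (hs : 0 ≤ s) :
    ENNReal.ofReal (Real.exp (-c)) ^ s = ENNReal.ofReal (Real.exp (-s * c)) := by
  rw [ENNReal.ofReal_rpow_of_nonneg (Real.exp_pos _).le hs, ← Real.exp_mul]
  congr 2
  ring

theorem tendsto_card_atTop [Infinite G] (hmono : Monotone Fseq)
    (hexh : ∀ g : G, ∃ n, g ∈ Fseq n) :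
    Tendsto (fun n => ((Fseq n).card : ℝ)) atTop atTop := by
  refine tendsto_natCast_atTop_atTop.comp ?_
  have hT : ∀ T : Finset G, ∃ n, T ⊆ Fseq n := by
    intro T
    choose m hm using hexh
    exact ⟨T.sup m, fun g hg => hmono (Finset.le_sup hg) (hm g)⟩
  refine tendsto_atTop_atTop_of_monotone (fun a b h => Finset.card_le_card (hmono h)) fun R => ?_
  obtain ⟨T, hTc⟩ := Infinite.exists_subset_card_eq G R
  obtain ⟨n, hn⟩ := hT T
  exact ⟨n, hTc ▸ Finset.card_le_card hn⟩

/-- A set that is small for the metric lies in a cylinder over some `Fseq n` whose weight is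
controlled by the diameter of the set. -/
theorem exists_index_of_sdiam_le [Infinite G] (hne : ∀ n, (Fseq n).Nonempty)
    (hmono : Monotone Fseq) (hexh : ∀ g : G, ∃ n, g ∈ Fseq n) {E : Set (G → A)} {N : ℕ}
    (h : sdiam Fseq E ≤ ENNReal.ofReal (Real.exp (-((Fseq N).card : ℝ))))
    {s η : ℝ} (hs : 0 ≤ s) (hη : 0 < η) {δ : ℝ≥0∞} (hδ : 0 < δ) :
    ∃ n, N ≤ n ∧ (∀ x ∈ E, ∀ y ∈ E, ∀ g ∈ Fseq n, x g = y g) ∧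
      ENNReal.ofReal (Real.exp (-(s + η) * ((Fseq n).card : ℝ))) ≤ sdiam Fseq E ^ s + δ := by
  by_cases hall : ∀ n, ∀ x ∈ E, ∀ y ∈ E, ∀ g ∈ Fseq n, x g = y g
  · have hlim : Tendsto
        (fun n => ENNReal.ofReal (Real.exp (-(s + η) * ((Fseq n).card : ℝ)))) atTop (𝓝 0) := by
      rw [← ENNReal.ofReal_zero]
      refine ENNReal.tendsto_ofReal (Real.tendsto_exp_atBot.comp ?_)
      exact (tendsto_card_atTop hmono hexh).const_mul_atTop_of_neg (by linarith)
    obtain ⟨n, hn, hNn⟩ := ((hlim.eventually_lt_const hδ).and (eventually_ge_atTop N)).exists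
    exact ⟨n, hNn, hall n, hn.le.trans le_add_self⟩
  · have hN := eq_on_of_sdiam_le hne hmono hexh h
    have hex : ∃ k, ¬ ∀ x ∈ E, ∀ y ∈ E, ∀ g ∈ Fseq (N + k), x g = y g := by
      obtain ⟨n, hn⟩ := not_forall.1 hall
      exact ⟨n, fun h' => hn fun x hx y hy g hg =>
        h' x hx y hy g (hmono (Nat.le_add_left n N) hg)⟩
    have hspec := Nat.find_spec hex
    obtain ⟨k, hk⟩ : ∃ k, Nat.find hex = k + 1 :=
      Nat.exists_eq_succ_of_ne_zero fun h0 => by rw [h0] at hspec; exact hspec hN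
    have hmin := not_not.1 (Nat.find_min hex (m := k) (by omega))
    rw [hk] at hspec
    refine ⟨N + k, Nat.le_add_right N k, hmin, ?_⟩
    push Not at hspec
    obtain ⟨x, hx, y, hy, g, hg, hxy⟩ := hspec
    have hd : ENNReal.ofReal (Real.exp (-((Fseq (N + k)).card : ℝ))) ≤ sdiam Fseq E :=
      (ENNReal.ofReal_le_ofReal (exp_le_subshiftDist hmono fun h' => hxy (h' g hg))).trans
        (subshiftDist_le_sdiam hx hy)
    calc ENNReal.ofReal (Real.exp (-(s + η) * ((Fseq (N + k)).card : ℝ)))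
        ≤ ENNReal.ofReal (Real.exp (-s * ((Fseq (N + k)).card : ℝ))) := by
          gcongr
          linarith
      _ = ENNReal.ofReal (Real.exp (-((Fseq (N + k)).card : ℝ))) ^ s :=
          (ofReal_exp_neg_rpow _ hs).symm
      _ ≤ sdiam Fseq E ^ s := ENNReal.rpow_le_rpow hd hs
      _ ≤ sdiam Fseq E ^ s + δ := le_self_add

end Metric

section Upper

variable {G : Type*} [Group G] {A : Type*} {Fseq : ℕ → Finset G}

theorem tsum_range_le {α β : Type*} (f : α → β) (w : β → ℝ≥0∞) :
    ∑' b : Set.range f, w b ≤ ∑' a, w (f a) :=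
  ENNReal.tsum_le_tsum_comp_of_surjective Set.rangeFactorization_surjective
    (fun b : Set.range f => w b)

/-- The cover of `A^G` by the cylinders over the identity. -/
noncomputable def coordCover (G A : Type*) [Group G] [Fintype A] : Finset (Set (G → A)) :=
  Finset.univ.image fun a : A => {x : G → A | x 1 = a}

theorem isFiniteOpenCoverOn_coordCover [Fintype A] [TopologicalSpace A] [DiscreteTopology A]
    (X : Set (G → A)) : IsFiniteOpenCoverOn (coordCover G A) X := by
  refine ⟨fun V hV => ?_, fun x _ => ⟨{y | y 1 = x 1}, ?_, rfl⟩⟩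
  · obtain ⟨a, -, rfl⟩ := Finset.mem_image.1 hV
    exact (isOpen_discrete ({a} : Set A)).preimage
      (continuous_apply (A := fun _ : G => A) (1 : G))
  · exact Finset.mem_coe.2 (Finset.mem_image_of_mem _ (Finset.mem_univ _))

theorem eq_on_of_mem_nameSet [Fintype A] {F : Finset G} {u : G → Set (G → A)}
    (hu : ∀ g ∈ F, u g ∈ coordCover G A) :
    ∀ x ∈ nameSet F u, ∀ y ∈ nameSet F u, ∀ g ∈ F, x g = y g := by
  intro x hx y hy g hg
  have hxg := hx g hg
  have hyg := hy g hg
  obtain ⟨a, -, ha⟩ := Finset.mem_image.1 (hu g hg)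
  rw [← ha] at hxg hyg
  simp only [Set.mem_ofPred_eq, shift, one_mul] at hxg hyg
  rw [hxg, hyg]

theorem hMeasure_eq_zero_of_bowenMlim [Infinite G] [Fintype A]
    (hmono : Monotone Fseq) (hexh : ∀ g : G, ∃ n, g ∈ Fseq n) (X : Set (G → A)) {s : ℝ}
    (hs : 0 ≤ s) (h : bowenMlim Fseq (coordCover G A) X s = 0) : hMeasure Fseq s X = 0 := by
  refine le_antisymm (iSup₂_le fun ε hε => ?_) bot_le
  have hlim : Tendsto (fun n => Real.exp (-((Fseq n).card : ℝ))) atTop (𝓝 0) :=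
    Real.tendsto_exp_neg_atTop_nhds_zero.comp (tendsto_card_atTop hmono hexh)
  obtain ⟨N, hN⟩ := (hlim.eventually_lt_const hε).exists
  have hM : bowenM Fseq (coordCover G A) X N s = 0 :=
    le_antisymm (h ▸ le_iSup (fun N => bowenM Fseq (coordCover G A) X N s) N) bot_le
  refine ENNReal.le_of_forall_pos_le_add fun δ hδ _ => ?_
  have hlt : bowenM Fseq (coordCover G A) X N s < δ := by
    rw [hM]; exact_mod_cast hδ
  simp only [bowenM, iInf_lt_iff] at hlt
  obtain ⟨Λ, hΛ, hcov, hsum⟩ := hlt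
  have hcount : Countable Λ := by
    have := Summable.countable_support_ennreal (hsum.trans ENNReal.coe_lt_top).ne
    refine Set.countable_univ_iff.1 (this.mono fun p _ => ?_)
    simp [Real.exp_pos]
  let e : Λ → Set (G → A) := fun p => nameSet (Fseq p.1.1) p.1.2
  have hd : ∀ p : Λ,
      sdiam Fseq (e p) ≤ ENNReal.ofReal (Real.exp (-((Fseq p.1.1).card : ℝ))) := fun p =>
    sdiam_le_exp hmono hexh (eq_on_of_mem_nameSet (hΛ p p.2).2)
  refine iInf₂_le_of_le (Set.range e) (Set.countable_range e) ?_
  refine iInf₂_le_of_le ?_ ?_ ?_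
  · intro x hx
    obtain ⟨p, hp, hxp⟩ := Set.mem_iUnion₂.1 (hcov hx)
    exact ⟨_, ⟨⟨p, hp⟩, rfl⟩, hxp⟩
  · rintro _ ⟨p, rfl⟩
    refine (hd p).trans (ENNReal.ofReal_le_ofReal (le_trans ?_ hN.le))
    have := Finset.card_le_card (hmono (hΛ p p.2).1)
    gcongr
  · calc ∑' E : Set.range e, sdiam Fseq (E : Set (G → A)) ^ s
        ≤ ∑' p : Λ, sdiam Fseq (e p) ^ s := tsum_range_le e fun E => sdiam Fseq E ^ s
      _ ≤ ∑' p : Λ, ENNReal.ofReal (Real.exp (-s * ((Fseq p.1.1).card : ℝ))) := by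
          refine ENNReal.tsum_le_tsum fun p => ?_
          rw [← ofReal_exp_neg_rpow _ hs]
          exact ENNReal.rpow_le_rpow (hd p) hs
      _ ≤ 0 + δ := by rw [zero_add]; exact hsum.le

end Upper

section Lower

variable {G : Type*} [Group G] [DecidableEq G] {A : Type*} {Fseq : ℕ → Finset G}

theorem exists_lebesgue_finset {ι B : Type*} [TopologicalSpace B] [DiscreteTopology B]
    {X : Set (ι → B)} (hX : IsCompact X) {𝒰 : Set (Set (ι → B))} (hopen : ∀ V ∈ 𝒰, IsOpen V)
    (hcov : X ⊆ ⋃₀ 𝒰) :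
    ∃ K : Finset ι, ∀ x ∈ X, ∃ V ∈ 𝒰, ∀ y : ι → B, (∀ k ∈ K, y k = x k) → y ∈ V := by
  classical
  refine hX.induction_on (p := fun S => ∃ K : Finset ι, ∀ x ∈ S, ∃ V ∈ 𝒰, ∀ y : ι → B,
    (∀ k ∈ K, y k = x k) → y ∈ V) ⟨∅, by simp⟩ ?_ ?_ ?_
  · rintro S T hST ⟨K, hK⟩
    exact ⟨K, fun x hx => hK x (hST hx)⟩
  · rintro S T ⟨K, hK⟩ ⟨L, hL⟩
    refine ⟨K ∪ L, ?_⟩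
    rintro x (hx | hx)
    · obtain ⟨V, hV, h⟩ := hK x hx
      exact ⟨V, hV, fun y hy => h y fun k hk => hy k (Finset.mem_union_left _ hk)⟩
    · obtain ⟨V, hV, h⟩ := hL x hx
      exact ⟨V, hV, fun y hy => h y fun k hk => hy k (Finset.mem_union_right _ hk)⟩
  · intro x hx
    obtain ⟨V, hV, hxV⟩ := hcov hx
    obtain ⟨K, u, hu, hsub⟩ := isOpen_pi_iff.1 (hopen V hV) x hxV
    refine ⟨{y | ∀ k ∈ K, y k = x k}, mem_nhdsWithin_of_mem_nhds ?_, K, fun y hy =>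
      ⟨V, hV, fun z hz => hsub fun k hk => ?_⟩⟩
    · have : {y : ι → B | ∀ k ∈ K, y k = x k} = (K : Set ι).pi fun k => {x k} := by
        ext y; simp
      rw [this]
      exact set_pi_mem_nhds K.finite_toSet fun k _ => by simp
    · rw [hz k hk, hy k hk]
      exact (hu k hk).2

/-- The elements `g` of `F` for which `K * g` is not contained in `F`. -/
noncomputable def translateBoundary (K F : Finset G) : Finset G :=
  F.filter fun g => ∃ k ∈ K, k * g ∉ F

theorem card_translateBoundary_le (K F : Finset G) :
    (translateBoundary K F).card ≤
      ∑ k ∈ K, (symmDiff F (F.image fun h => k * h)).card := by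
  have hsub : translateBoundary K F ⊆ K.biUnion fun k => F.filter fun g => k * g ∉ F := by
    intro g hg
    obtain ⟨hgF, k, hk, hkg⟩ := Finset.mem_filter.1 hg
    exact Finset.mem_biUnion.2 ⟨k, hk, Finset.mem_filter.2 ⟨hgF, hkg⟩⟩
  refine (Finset.card_le_card hsub).trans (Finset.card_biUnion_le.trans ?_)
  refine Finset.sum_le_sum fun k _ => Finset.card_le_card_of_injOn (fun g => k * g) ?_
    (mul_right_injective k).injOn
  intro g hg
  obtain ⟨hgF, hkg⟩ := Finset.mem_filter.1 hg
  exact Finset.mem_coe.2 (Finset.mem_symmDiff.2 (Or.inr ⟨Finset.mem_image_of_mem _ hgF, hkg⟩))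

theorem IsFolnerSeq.tendsto_translateBoundary (hF : IsFolnerSeq Fseq) (K : Finset G) :
    Tendsto (fun n => ((translateBoundary K (Fseq n)).card : ℝ) / (Fseq n).card)
      atTop (𝓝 0) := by
  have hsum := tendsto_finsetSum K fun k _ => hF.2 k
  rw [Finset.sum_const_zero] at hsum
  refine squeeze_zero (fun n => by positivity) (fun n => ?_) hsum
  rw [← Finset.sum_div]
  gcongr
  exact_mod_cast card_translateBoundary_le K (Fseq n)

/-- The name that follows `u` on `B` and `c` elsewhere. -/
noncomputable def patchName (𝒰 : Finset (Set (G → A))) (B : Finset G) (c : G → Set (G → A))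
    (u : B → 𝒰) : G → Set (G → A) :=
  fun g => if h : g ∈ B then (u ⟨g, h⟩ : Set (G → A)) else c g

theorem bowenMlim_eq_zero_of_hMeasure [Infinite G] [Finite A] [TopologicalSpace A]
    [DiscreteTopology A] (hFol : IsFolnerSeq Fseq) (hmono : Monotone Fseq)
    (hexh : ∀ g : G, ∃ n, g ∈ Fseq n) {X : Set (G → A)} (hX : IsSubshift X)
    {𝒰 : Finset (Set (G → A))} (h𝒰 : IsFiniteOpenCoverOn 𝒰 X) {s η : ℝ} (hs : 0 ≤ s)
    (hη : 0 < η) (h : hMeasure Fseq s X = 0) : bowenMlim Fseq 𝒰 X (s + 2 * η) = 0 := by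
  refine le_antisymm (iSup_le fun N₀ => ?_) bot_le
  obtain ⟨K, hK⟩ := exists_lebesgue_finset hX.1.isCompact (𝒰 := (𝒰 : Set (Set (G → A))))
    h𝒰.1 h𝒰.2
  choose! V hV𝒰 hV using hK
  have hbd : ∀ᶠ n in atTop, ((𝒰.card : ℝ) + 1) ^ (translateBoundary K (Fseq n)).card ≤
      Real.exp (η * (Fseq n).card) := by
    have hlim := (hFol.tendsto_translateBoundary K).mul_const (Real.log ((𝒰.card : ℝ) + 1))
    rw [zero_mul] at hlim
    filter_upwards [hlim.eventually_lt_const hη] with n hn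
    have hpos : (0 : ℝ) < (Fseq n).card := by exact_mod_cast (hFol.1 n).card_pos
    rw [div_mul_eq_mul_div, div_lt_iff₀ hpos] at hn
    calc ((𝒰.card : ℝ) + 1) ^ (translateBoundary K (Fseq n)).card
        = Real.exp ((translateBoundary K (Fseq n)).card * Real.log ((𝒰.card : ℝ) + 1)) := by
          rw [Real.exp_nat_mul, Real.exp_log (by positivity)]
      _ ≤ Real.exp (η * (Fseq n).card) := Real.exp_le_exp.2 hn.le
  obtain ⟨N₁, hN₁⟩ := eventually_atTop.1 hbd
  set N := max N₀ N₁
  refine ENNReal.le_of_forall_pos_le_add fun δ hδ _ => ?_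
  have hδ2 : (0 : ℝ≥0∞) < δ / 2 := ENNReal.half_pos (by exact_mod_cast hδ.ne')
  have hlt : (⨅ (𝓔 : Set (Set (G → A))) (_ : 𝓔.Countable) (_ : X ⊆ ⋃₀ 𝓔)
      (_ : ∀ E ∈ 𝓔, sdiam Fseq E ≤ ENNReal.ofReal (Real.exp (-((Fseq N).card : ℝ)))),
      ∑' E : 𝓔, sdiam Fseq (E : Set (G → A)) ^ s) < (δ : ℝ≥0∞) / 2 := by
    refine lt_of_le_of_lt ?_ hδ2
    rw [← h]
    exact le_iSup₂ (f := fun (ε : ℝ) (_ : 0 < ε) =>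
      ⨅ (𝓔 : Set (Set (G → A))) (_ : 𝓔.Countable) (_ : X ⊆ ⋃₀ 𝓔)
      (_ : ∀ E ∈ 𝓔, sdiam Fseq E ≤ ENNReal.ofReal ε),
      ∑' E : 𝓔, sdiam Fseq (E : Set (G → A)) ^ s) _ (Real.exp_pos _)
  simp only [iInf_lt_iff] at hlt
  obtain ⟨𝓔, hcount, hcov, hdiam, hsum⟩ := hlt
  have : Countable 𝓔 := hcount
  obtain ⟨δ', hδ'pos, hδ'sum⟩ := ENNReal.exists_pos_sum_of_countable' hδ2.ne' 𝓔
  choose n hNn hagree hweight using fun E : 𝓔 =>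
    exists_index_of_sdiam_le hFol.1 hmono hexh (hdiam E E.2) hs hη (hδ'pos E)
  let I := {E : 𝓔 // ((E : Set (G → A)) ∩ X).Nonempty}
  let pt : I → G → A := fun E => E.2.some
  have hptE : ∀ E : I, pt E ∈ (E.1 : Set (G → A)) := fun E => E.2.some_mem.1
  have hptX : ∀ E : I, pt E ∈ X := fun E => E.2.some_mem.2
  let B : I → Finset G := fun E => translateBoundary K (Fseq (n E.1))
  let name : (Σ E : I, (B E → 𝒰)) → ℕ × (G → Set (G → A)) := fun p =>
    (n p.1.1, patchName 𝒰 (B p.1) (fun g => V (shift g (pt p.1))) p.2)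
  refine iInf₂_le_of_le (Set.range name) ?_ (iInf_le_of_le ?_ ?_)
  · rintro _ ⟨⟨E, u⟩, rfl⟩
    refine ⟨(le_max_left _ _).trans (hNn E.1), fun g hg => ?_⟩
    simp only [name, patchName]
    split_ifs with hB
    · exact (u ⟨g, hB⟩).2
    · exact hV𝒰 _ (hX.2 g _ (hptX E))
  · intro x hx
    obtain ⟨E, hE, hxE⟩ := hcov hx
    let E' : I := ⟨⟨E, hE⟩, ⟨x, hxE, hx⟩⟩
    have hW : ∀ g, ∃ W ∈ 𝒰, shift g x ∈ W := fun g => h𝒰.2 (hX.2 g x hx)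
    choose W hW𝒰 hxW using hW
    refine Set.mem_iUnion₂.2 ⟨_, ⟨⟨E', fun b => ⟨W b, hW𝒰 b⟩⟩, rfl⟩, fun g hg => ?_⟩
    simp only [name, patchName]
    split_ifs with hB
    · exact hxW g
    · refine hV _ (hX.2 g _ (hptX E')) _ fun k hk => ?_
      refine hagree E'.1 x hxE _ (hptE E') _ ?_
      by_contra hkg
      exact hB (Finset.mem_filter.2 ⟨hg, k, hk, hkg⟩)
  · have hfib : ∀ E : I, ∑' _ : B E → 𝒰,
        ENNReal.ofReal (Real.exp (-(s + 2 * η) * ((Fseq (n E.1)).card : ℝ))) ≤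
        sdiam Fseq (E.1 : Set (G → A)) ^ s + δ' E.1 := by
      intro E
      refine le_trans ?_ (hweight E.1)
      rw [tsum_fintype, Finset.sum_const, nsmul_eq_mul, Finset.card_univ, Fintype.card_fun,
        Fintype.card_coe, Fintype.card_coe, ← ENNReal.ofReal_natCast,
        ← ENNReal.ofReal_mul (by positivity)]
      refine ENNReal.ofReal_le_ofReal ?_
      have h1 := hN₁ (n E.1) ((le_max_right _ _).trans (hNn E.1))
      have h2 : ((𝒰.card ^ (B E).card : ℕ) : ℝ) ≤ Real.exp (η * (Fseq (n E.1)).card) := by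
        refine le_trans ?_ h1
        push_cast
        gcongr
        linarith
      calc ((𝒰.card ^ (B E).card : ℕ) : ℝ) *
            Real.exp (-(s + 2 * η) * ((Fseq (n E.1)).card : ℝ))
          ≤ Real.exp (η * (Fseq (n E.1)).card) *
            Real.exp (-(s + 2 * η) * ((Fseq (n E.1)).card : ℝ)) := by gcongr
        _ = Real.exp (-(s + η) * ((Fseq (n E.1)).card : ℝ)) := by
          rw [← Real.exp_add]; congr 1; ring
    calc ∑' p : Set.range name,
          ENNReal.ofReal (Real.exp (-(s + 2 * η) * ((Fseq p.1.1).card : ℝ)))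
        ≤ ∑' p : Σ E : I, (B E → 𝒰),
          ENNReal.ofReal (Real.exp (-(s + 2 * η) * ((Fseq (n p.1.1)).card : ℝ))) :=
          tsum_range_le name fun q =>
            ENNReal.ofReal (Real.exp (-(s + 2 * η) * ((Fseq q.1).card : ℝ)))
      _ = ∑' E : I, ∑' _ : B E → 𝒰,
          ENNReal.ofReal (Real.exp (-(s + 2 * η) * ((Fseq (n E.1)).card : ℝ))) :=
          ENNReal.tsum_sigma' _
      _ ≤ ∑' E : I, (sdiam Fseq (E.1 : Set (G → A)) ^ s + δ' E.1) :=
          ENNReal.tsum_le_tsum hfib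
      _ ≤ ∑' E : 𝓔, (sdiam Fseq (E : Set (G → A)) ^ s + δ' E) :=
          ENNReal.tsum_comp_le_tsum_of_injective Subtype.val_injective
            fun E : 𝓔 => sdiam Fseq (E : Set (G → A)) ^ s + δ' E
      _ = ∑' E : 𝓔, sdiam Fseq (E : Set (G → A)) ^ s + ∑' E, δ' E := ENNReal.tsum_add
      _ ≤ δ / 2 + δ / 2 := add_le_add hsum.le hδ'sum.le
      _ = 0 + δ := by rw [ENNReal.add_halves, zero_add]

end Lower

/-- For a subshift `X ⊆ A^G` over a countably infinite (discrete) amenable group `G`,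
with metric associated to a nested tempered Følner sequence `{F n}` exhausting `G`, the
Hausdorff dimension of `X` equals its Bowen dimensional entropy:
`dim(X) = h^B_top(X,{F n})`. -/
theorem hDim_eq_bowenEntropy
    {G : Type*} [Group G] [DecidableEq G] [Countable G] [Infinite G]
    {A : Type*} [Fintype A] [TopologicalSpace A] [DiscreteTopology A]
    (Fseq : ℕ → Finset G) (hFol : IsFolnerSeq Fseq) (hTemp : IsTemperedSeq Fseq)
    (hmono : ∀ n, Fseq n ⊆ Fseq (n + 1)) (hexh : ∀ g : G, ∃ n, g ∈ Fseq n)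
    (X : Set (G → A)) (hX : IsSubshift X) :
    hDim Fseq X = bowenEntropy Fseq X := by
  have hmono' : Monotone Fseq := monotone_nat_of_le_succ hmono
  refine le_antisymm ?_ (iSup₂_le fun 𝒰 h𝒰 => le_iInf₂ fun s hs => ?_)
  · refine le_trans ?_
      (le_iSup₂ (f := fun 𝒰 (_ : IsFiniteOpenCoverOn 𝒰 X) => bowenEntropyCover Fseq 𝒰 X)
        _ (isFiniteOpenCoverOn_coordCover X))
    exact le_iInf₂ fun s hs =>
      iInf₂_le s (hMeasure_eq_zero_of_bowenMlim hmono' hexh X s.coe_nonneg hs)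
  · refine ENNReal.le_of_forall_pos_le_add fun δ hδ _ => ?_
    have h0 := bowenMlim_eq_zero_of_hMeasure hFol hmono' hexh hX h𝒰 s.coe_nonneg
      (half_pos (NNReal.coe_pos.2 hδ)) hs
    rw [mul_div_cancel₀ _ two_ne_zero, ← NNReal.coe_add] at h0
    rw [← ENNReal.coe_add]
    exact iInf₂_le (s + δ) h0
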